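/- arXiv:1607.05997 — 6 statements merged into one kernel-verified Lean document; each statement's English description precedes it below -/
import Mathlib

section
/- Let S be a totally ordered semigroup and x, y ∈ S with x*y > y*x. Then for every natural number n ≥ 1 one has xⁿ*yⁿ ≥ (x*y)ⁿ > (y*x)ⁿ ≥ yⁿ*xⁿ, and for every n ≥ 2 all three inequalities are strict. -/
/-- `mpow x n` is the `n`-fold product `xⁿ` of `x` with itself, for `n ≥ 1`
(the value at `n = 0` is a junk value, never used below). -/
def mpow {S : Type*} [Mul S] (x : S) : ℕ → S
  | 0 => x
  | 1 => x
  | n + 2 => mpow x (n + 1) * x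

theorem mpow_succ {S : Type*} [Mul S] (x : S) {n : ℕ} (hn : 1 ≤ n) :
    mpow x (n + 1) = mpow x n * x := by
  obtain ⟨k, rfl⟩ := Nat.exists_eq_add_of_le' hn
  rfl

section OrderedSemigroup

variable {S : Type*} [Semigroup S] [LinearOrder S] [MulLeftStrictMono S] [MulRightStrictMono S]
  {x y : S} {n : ℕ}

theorem mul_mpow_lt_mpow_mul (h : y * x < x * y) (hn : 1 ≤ n) :
    y * mpow x n < mpow x n * y := by
  induction n, hn using Nat.le_induction with
  | base => exact h
  | succ n hn ih =>
    rw [mpow_succ x hn]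
    calc y * (mpow x n * x) = y * mpow x n * x := (mul_assoc _ _ _).symm
      _ < mpow x n * y * x := by gcongr
      _ = mpow x n * (y * x) := mul_assoc _ _ _
      _ < mpow x n * (x * y) := by gcongr
      _ = mpow x n * x * y := (mul_assoc _ _ _).symm

theorem mpow_mul_lt_mul_mpow (h : y * x < x * y) (hn : 1 ≤ n) :
    mpow y n * x < x * mpow y n := by
  induction n, hn using Nat.le_induction with
  | base => exact h
  | succ n hn ih =>
    rw [mpow_succ y hn]
    calc mpow y n * y * x = mpow y n * (y * x) := mul_assoc _ _ _
      _ < mpow y n * (x * y) := by gcongr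
      _ = mpow y n * x * y := (mul_assoc _ _ _).symm
      _ < x * mpow y n * y := by gcongr
      _ = x * (mpow y n * y) := mul_assoc _ _ _

theorem mpow_lt_mpow (h : y < x) (hn : 1 ≤ n) : mpow y n < mpow x n := by
  induction n, hn using Nat.le_induction with
  | base => exact h
  | succ n hn ih =>
    rw [mpow_succ x hn, mpow_succ y hn]
    calc mpow y n * y < mpow x n * y := by gcongr
      _ < mpow x n * x := by gcongr

theorem mpow_mul_mpow_succ_gt (h : y * x < x * y) (hn : 1 ≤ n) :
    mpow x n * mpow y n * (x * y) < mpow x (n + 1) * mpow y (n + 1) := by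
  rw [mpow_succ x hn, mpow_succ y hn]
  calc mpow x n * mpow y n * (x * y) = mpow x n * (mpow y n * x) * y := by
        simp only [mul_assoc]
    _ < mpow x n * (x * mpow y n) * y := by
        gcongr mpow x n * ?_ * y
        exact mpow_mul_lt_mul_mpow h hn
    _ = mpow x n * x * (mpow y n * y) := by simp only [mul_assoc]

theorem mpow_mul_mpow_succ_lt (h : y * x < x * y) (hn : 1 ≤ n) :
    mpow y (n + 1) * mpow x (n + 1) < mpow y n * mpow x n * (y * x) := by
  rw [mpow_succ x hn, mpow_succ y hn]
  calc mpow y n * y * (mpow x n * x) = mpow y n * (y * mpow x n) * x := by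
        simp only [mul_assoc]
    _ < mpow y n * (mpow x n * y) * x := by
        gcongr mpow y n * ?_ * x
        exact mul_mpow_lt_mpow_mul h hn
    _ = mpow y n * mpow x n * (y * x) := by simp only [mul_assoc]

theorem mpow_mul_le (h : y * x < x * y) (hn : 1 ≤ n) :
    mpow (x * y) n ≤ mpow x n * mpow y n := by
  induction n, hn using Nat.le_induction with
  | base => exact le_rfl
  | succ n hn ih =>
    rw [mpow_succ (x * y) hn]
    have := mulRightMono_of_mulRightStrictMono S
    exact (mul_le_mul_left ih _).trans (mpow_mul_mpow_succ_gt h hn).le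

theorem le_mpow_mul (h : y * x < x * y) (hn : 1 ≤ n) :
    mpow y n * mpow x n ≤ mpow (y * x) n := by
  induction n, hn using Nat.le_induction with
  | base => exact le_rfl
  | succ n hn ih =>
    rw [mpow_succ (y * x) hn]
    have := mulRightMono_of_mulRightStrictMono S
    exact (mpow_mul_mpow_succ_lt h hn).le.trans (mul_le_mul_left ih _)

end OrderedSemigroup

/-- In a totally ordered semigroup, if `x*y > y*x` then for every `n ≥ 1` we have
`xⁿ*yⁿ ≥ (x*y)ⁿ > (y*x)ⁿ ≥ yⁿ*xⁿ`, and for `n ≥ 2` all three inequalities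
are strict. -/
theorem stmt1 {S : Type*} [Semigroup S] [LinearOrder S]
    (hmul : ∀ x y z : S, x < y → x * z < y * z ∧ z * x < z * y)
    (x y : S) (hxy : y * x < x * y) :
    (∀ n : ℕ, 1 ≤ n →
      mpow (x * y) n ≤ mpow x n * mpow y n ∧
      mpow (y * x) n < mpow (x * y) n ∧
      mpow y n * mpow x n ≤ mpow (y * x) n) ∧
    (∀ n : ℕ, 2 ≤ n →
      mpow (x * y) n < mpow x n * mpow y n ∧
      mpow y n * mpow x n < mpow (y * x) n) := by
  have : MulLeftStrictMono S := ⟨fun z _ _ h => (hmul _ _ z h).2⟩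
  have : MulRightStrictMono S := ⟨fun z _ _ h => (hmul _ _ z h).1⟩
  have := mulRightMono_of_mulRightStrictMono S
  refine ⟨fun n hn => ⟨mpow_mul_le hxy hn, mpow_lt_mpow hxy hn, le_mpow_mul hxy hn⟩,
    fun n hn => ?_⟩
  obtain ⟨m, rfl⟩ := Nat.exists_eq_add_of_le' (one_le_two.trans hn)
  have hm : 1 ≤ m := by omega
  rw [mpow_succ (x * y) hm, mpow_succ (y * x) hm]
  exact ⟨(mul_le_mul_left (mpow_mul_le hxy hm) _).trans_lt (mpow_mul_mpow_succ_gt hxy hm),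
    (mpow_mul_mpow_succ_lt hxy hm).trans_le (mul_le_mul_left (le_mpow_mul hxy hm) _)⟩
end

section
/- Let S be a non-anomalous totally ordered semigroup, x ∈ S positive and y ∈ S negative. Then there exists a natural number n ≥ 1 such that xⁿ*y is positive. -/
/-- `x, y` with `x > y` form an anomalous pair if `xⁿ < y^(n+1)` for every `n ≥ 1`,
or `yⁿ > x^(n+1)` for every `n ≥ 1`. -/
def IsAnomalousPair {S : Type*} [Mul S] [LT S] (x y : S) : Prop :=
  y < x ∧ ((∀ n : ℕ, 1 ≤ n → mpow x n < mpow y (n + 1)) ∨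
           (∀ n : ℕ, 1 ≤ n → mpow x (n + 1) < mpow y n))

theorem mpow_add_two {S : Type*} [Mul S] (x : S) (n : ℕ) :
    mpow x (n + 2) = mpow x (n + 1) * x := rfl

theorem mpow_add_two' {S : Type*} [Semigroup S] (x : S) (n : ℕ) :
    mpow x (n + 2) = x * mpow x (n + 1) := by
  induction n with
  | zero => rfl
  | succ n ih => rw [mpow_add_two, ih, mul_assoc, ← mpow_add_two, ih]

section Preorder

variable {S : Type*} [Semigroup S] [Preorder S] [MulLeftMono S] [MulRightMono S]

theorem mpow_mul_le_mul_mpow {x y : S} (h : x * y ≤ y * x) (n : ℕ) :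
    mpow x (n + 1) * y ≤ y * mpow x (n + 1) := by
  induction n with
  | zero => exact h
  | succ n ih =>
    calc mpow x (n + 1) * x * y = mpow x (n + 1) * (x * y) := mul_assoc _ _ _
      _ ≤ mpow x (n + 1) * (y * x) := by gcongr
      _ = mpow x (n + 1) * y * x := (mul_assoc _ _ _).symm
      _ ≤ y * mpow x (n + 1) * x := by gcongr
      _ = y * (mpow x (n + 1) * x) := mul_assoc _ _ _

theorem mpow_mul_le_mpow_mul_mpow {x y : S} (h : y * x ≤ x * y) (n : ℕ) :
    mpow (x * y) (n + 1) ≤ mpow x (n + 1) * mpow y (n + 1) := by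
  induction n with
  | zero => exact le_rfl
  | succ n ih =>
    calc mpow (x * y) (n + 1) * (x * y)
        ≤ mpow x (n + 1) * mpow y (n + 1) * (x * y) := by gcongr
      _ = mpow x (n + 1) * (mpow y (n + 1) * x) * y := by simp only [mul_assoc]
      _ ≤ mpow x (n + 1) * (x * mpow y (n + 1)) * y := by
        gcongr mpow x (n + 1) * ?_ * y
        exact mpow_mul_le_mul_mpow h n
      _ = mpow x (n + 1) * x * (mpow y (n + 1) * y) := by simp only [mul_assoc]

theorem mpow_mul_le_mpow_mul_mpow' {x y : S} (h : x * y ≤ y * x) (n : ℕ) :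
    mpow (x * y) (n + 1) ≤ mpow y (n + 1) * mpow x (n + 1) := by
  induction n with
  | zero => exact h
  | succ n ih =>
    calc mpow (x * y) (n + 1) * (x * y)
        ≤ mpow y (n + 1) * mpow x (n + 1) * (x * y) := by gcongr
      _ = mpow y (n + 1) * (mpow x (n + 2) * y) := by simp only [mpow_add_two, mul_assoc]
      _ ≤ mpow y (n + 1) * (y * mpow x (n + 2)) := by
        gcongr mpow y (n + 1) * ?_
        exact mpow_mul_le_mul_mpow h (n + 1)
      _ = mpow y (n + 1) * y * mpow x (n + 2) := (mul_assoc _ _ _).symm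

end Preorder

/-- If `S` is a non-anomalous totally ordered semigroup, `x ∈ S` is positive and
`y ∈ S` is negative, then there exists `n ≥ 1` such that `xⁿ*y` is positive. -/
theorem stmt4 {S : Type*} [Semigroup S] [LinearOrder S]
    (hmul : ∀ x y z : S, x < y → x * z < y * z ∧ z * x < z * y)
    (hna : ∀ x y : S, ¬ IsAnomalousPair x y)
    (x y : S) (hx : x < x * x) (hy : y * y < y) :
    ∃ n : ℕ, 1 ≤ n ∧ mpow x n * y < (mpow x n * y) * (mpow x n * y) := by
  have : MulLeftMono S := ⟨fun z => (StrictMono.monotone fun _ _ h => (hmul _ _ z h).2 :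
    Monotone (z * ·))⟩
  have : MulRightMono S := ⟨fun z => (StrictMono.monotone fun _ _ h => (hmul _ _ z h).1 :
    Monotone (· * z))⟩
  have cancel_left {a b c : S} (h : a * b < a * c) : b < c :=
    lt_of_not_ge fun hcb => h.not_ge (by gcongr)
  have cancel_right {a b c : S} (h : b * a < c * a) : b < c :=
    lt_of_not_ge fun hcb => h.not_ge (by gcongr)
  have lt_mul (z : S) : z < x * z :=
    cancel_left (a := x) (by simpa only [mul_assoc] using (hmul _ _ z hx).1)
  by_contra! H
  have lt_succ (n : ℕ) : mpow x (n + 1) * y < mpow x (n + 2) * y := by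
    rw [mpow_add_two', mul_assoc]
    exact lt_mul _
  have neg (n : ℕ) : mpow x (n + 1) * y * (mpow x (n + 1) * y) < mpow x (n + 1) * y := by
    set a := mpow x (n + 1) * y
    have hpa : mpow x (n + 2) * y * a < mpow x (n + 2) * y :=
      (hmul _ _ _ (lt_succ n)).2.trans_le (H (n + 2) (by lia))
    refine cancel_left (a := mpow x (n + 2) * y) ?_
    rw [← mul_assoc]
    exact (hmul _ _ a hpa).1
  have mul_lt (n : ℕ) (z : S) : mpow x (n + 1) * y * z < z :=
    cancel_left (a := mpow x (n + 1) * y)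
      (by simpa only [mul_assoc] using (hmul _ _ z (neg n)).1)
  have mul_lt' (n : ℕ) (z : S) : z * (mpow x (n + 1) * y) < z :=
    cancel_right (a := mpow x (n + 1) * y)
      (by simpa only [mul_assoc] using (hmul _ _ z (neg n)).2)
  refine hna (x * y) y ⟨lt_mul y, Or.inr fun n hn => ?_⟩
  obtain ⟨n, rfl⟩ := Nat.exists_eq_add_of_le' hn
  rcases le_total (x * y) (y * x) with h | h
  · refine (mpow_mul_le_mpow_mul_mpow' h (n + 1)).trans_lt (cancel_right (a := y) ?_)
    rw [mul_assoc, ← mpow_add_two]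
    exact mul_lt' _ _
  · refine (mpow_mul_le_mpow_mul_mpow h (n + 1)).trans_lt ?_
    rw [mpow_add_two' y, ← mul_assoc]
    exact mul_lt _ _
end

section
/- Every non-anomalous totally ordered semigroup is commutative: if S is a non-anomalous TOS then x*y = y*x for all x, y ∈ S. -/
theorem mpow_mul_swap {S : Type*} [Semigroup S] (x y : S) (n : ℕ) :
    mpow (x * y) (n + 2) = x * mpow (y * x) (n + 1) * y := by
  induction n with
  | zero => simp [mpow, mul_assoc]
  | succ k ih =>
    rw [mpow, ih, mpow]
    simp only [mul_assoc]

section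

variable {S : Type*} [Semigroup S] [LinearOrder S]

theorem lt_mul_of_lt_mul_self
    (hmul : ∀ x y z : S, x < y → x * z < y * z ∧ z * x < z * y)
    {x : S} (hx : x < x * x) (z : S) : z < x * z ∧ z < z * x := by
  constructor
  · by_contra! h
    have h1 := (hmul _ _ z hx).1
    rcases h.lt_or_eq with h | h
    · exact lt_asymm h1 (by simpa [mul_assoc] using (hmul _ _ x h).2)
    · simp [mul_assoc, h] at h1
  · by_contra! h
    have h1 := (hmul _ _ z hx).2
    rcases h.lt_or_eq with h | h
    · exact lt_asymm h1 (by simpa [mul_assoc] using (hmul _ _ x h).1)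
    · simp [← mul_assoc, h] at h1

theorem mul_lt_of_mul_self_lt
    (hmul : ∀ x y z : S, x < y → x * z < y * z ∧ z * x < z * y)
    {x : S} (hx : x * x < x) (z : S) : x * z < z ∧ z * x < z :=
  lt_mul_of_lt_mul_self (S := Sᵒᵈ) (fun a b c h => hmul b a c h) hx z

theorem mul_left_cancel_of_strictMono
    (hmul : ∀ x y z : S, x < y → x * z < y * z ∧ z * x < z * y)
    {x y z : S} (h : z * x = z * y) : x = y := by
  rcases lt_trichotomy x y with h1 | h1 | h1
  · exact absurd h (hmul _ _ z h1).2.ne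
  · exact h1
  · exact absurd h (hmul _ _ z h1).2.ne'

theorem mul_right_cancel_of_strictMono
    (hmul : ∀ x y z : S, x < y → x * z < y * z ∧ z * x < z * y)
    {x y z : S} (h : x * z = y * z) : x = y := by
  rcases lt_trichotomy x y with h1 | h1 | h1
  · exact absurd h (hmul _ _ z h1).1.ne
  · exact h1
  · exact absurd h (hmul _ _ z h1).1.ne'

theorem mul_comm_of_mul_self_eq
    (hmul : ∀ x y z : S, x < y → x * z < y * z ∧ z * x < z * y)
    {x : S} (hx : x * x = x) (y : S) : x * y = y * x := by
  have h1 : x * y = y :=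
    mul_left_cancel_of_strictMono hmul (z := x) (by rw [← mul_assoc, hx])
  have h2 : y * x = y :=
    mul_right_cancel_of_strictMono hmul (z := x) (by rw [mul_assoc, hx])
  rw [h1, h2]

theorem mul_comm_of_positive
    (hmul : ∀ x y z : S, x < y → x * z < y * z ∧ z * x < z * y)
    (hna : ∀ x y : S, ¬ IsAnomalousPair x y)
    {x y : S} (hx : x < x * x) (hy : y < y * y) : x * y = y * x := by
  have key : ∀ {x y : S}, x < x * x → y < y * y → ¬ x * y < y * x := by
    intro x y hx hy h
    refine hna _ _ ⟨h, Or.inl fun n hn => ?_⟩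
    obtain ⟨m, rfl⟩ := Nat.exists_eq_add_of_le' hn
    rw [mpow_mul_swap]
    exact (lt_mul_of_lt_mul_self hmul hx _).1.trans (lt_mul_of_lt_mul_self hmul hy _).2
  exact le_antisymm (not_lt.1 (key hy hx)) (not_lt.1 (key hx hy))

theorem mul_comm_of_negative
    (hmul : ∀ x y z : S, x < y → x * z < y * z ∧ z * x < z * y)
    (hna : ∀ x y : S, ¬ IsAnomalousPair x y)
    {x y : S} (hx : x * x < x) (hy : y * y < y) : x * y = y * x := by
  have key : ∀ {x y : S}, x * x < x → y * y < y → ¬ x * y < y * x := by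
    intro x y hx hy h
    refine hna _ _ ⟨h, Or.inr fun n hn => ?_⟩
    obtain ⟨m, rfl⟩ := Nat.exists_eq_add_of_le' hn
    rw [mpow_mul_swap]
    exact (mul_lt_of_mul_self_lt hmul hx _).2.trans (mul_lt_of_mul_self_lt hmul hy _).1
  exact le_antisymm (not_lt.1 (key hy hx)) (not_lt.1 (key hx hy))

theorem mul_comm_of_negative_of_positive
    (hmul : ∀ x y z : S, x < y → x * z < y * z ∧ z * x < z * y)
    (hna : ∀ x y : S, ¬ IsAnomalousPair x y)
    {x y : S} (hx : x * x < x) (hy : y < y * y) : x * y = y * x := by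
  have cancel_x (h : x * y * x = x * (x * y)) : x * y = y * x :=
    (mul_left_cancel_of_strictMono hmul (z := x) (by rw [← h, mul_assoc]))
  rcases lt_trichotomy (x * y * (x * y)) (x * y) with h | h | h
  · exact cancel_x (mul_comm_of_negative hmul hna h hx)
  · exact cancel_x (mul_comm_of_mul_self_eq hmul h x)
  · exact mul_right_cancel_of_strictMono hmul (z := y)
      ((mul_comm_of_positive hmul hna h hy).trans (mul_assoc _ _ _).symm)

end

/-- Every non-anomalous totally ordered semigroup is commutative. -/
theorem stmt5 {S : Type*} [Semigroup S] [LinearOrder S]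
    (hmul : ∀ x y z : S, x < y → x * z < y * z ∧ z * x < z * y)
    (hna : ∀ x y : S, ¬ IsAnomalousPair x y) :
    ∀ x y : S, x * y = y * x := by
  intro x y
  rcases lt_trichotomy (x * x) x with hx | hx | hx
  · rcases lt_trichotomy (y * y) y with hy | hy | hy
    · exact mul_comm_of_negative hmul hna hx hy
    · exact (mul_comm_of_mul_self_eq hmul hy x).symm
    · exact mul_comm_of_negative_of_positive hmul hna hx hy
  · exact mul_comm_of_mul_self_eq hmul hx y
  · rcases lt_trichotomy (y * y) y with hy | hy | hy
    · exact (mul_comm_of_negative_of_positive hmul hna hy hx).symm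
    · exact (mul_comm_of_mul_self_eq hmul hy x).symm
    · exact mul_comm_of_positive hmul hna hx hy
end

section
/- Let A and B be non-anomalous commutative totally ordered additive semigroups, let f₁, f₂ : A → B be morphisms, and let a ∈ A be a non-identity element with f₁(a) = f₂(a). Then f₁ = f₂. (A morphism between non-anomalous semigroups is determined by where it maps a single non-identity element.) -/
/-- `nsm a n` is the `n`-fold sum `n • a` of `a` with itself, for `n ≥ 1`
(the value at `n = 0` is a junk value, never used below). -/
def nsm {A : Type*} [Add A] (a : A) : ℕ → A
  | 0 => a
  | 1 => a
  | n + 2 => nsm a (n + 1) + a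

/-- `x, y` with `x > y` form an anomalous pair if `n•x < (n+1)•y` for every `n ≥ 1`,
or `n•y > (n+1)•x` for every `n ≥ 1`. -/
def IsAddAnomalousPair {A : Type*} [Add A] [LT A] (x y : A) : Prop :=
  y < x ∧ ((∀ n : ℕ, 1 ≤ n → nsm x n < nsm y (n + 1)) ∨
           (∀ n : ℕ, 1 ≤ n → nsm x (n + 1) < nsm y n))

/-- A morphism of totally ordered additive semigroups: an additive map that is
either strictly monotone or strictly antitone. -/
def IsMorphism {A B : Type*} [Add A] [Add B] [Preorder A] [Preorder B] (f : A → B) : Prop :=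
  (∀ x y : A, f (x + y) = f x + f y) ∧ (StrictMono f ∨ StrictAnti f)

theorem nsm_succ {A : Type*} [Add A] (x : A) {n : ℕ} (hn : 1 ≤ n) :
    nsm x (n + 1) = nsm x n + x := by
  obtain ⟨m, rfl⟩ := Nat.exists_eq_add_of_le' hn
  rfl

theorem nsm_add {A : Type*} [AddCommSemigroup A] (x y : A) {n : ℕ} (hn : 1 ≤ n) :
    nsm (x + y) n = nsm x n + nsm y n := by
  induction n, hn using Nat.le_induction with
  | base => rfl
  | succ n hn ih => rw [nsm_succ _ hn, nsm_succ _ hn, nsm_succ _ hn, ih]; ac_rfl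

theorem map_nsm {A B : Type*} [Add A] [Add B] {f : A → B}
    (hf : ∀ x y, f (x + y) = f x + f y) (x : A) {n : ℕ} (hn : 1 ≤ n) :
    f (nsm x n) = nsm (f x) n := by
  induction n, hn using Nat.le_induction with
  | base => rfl
  | succ n hn ih => rw [nsm_succ _ hn, nsm_succ _ hn, hf, ih]

theorem nsm_toDual {B : Type*} [Add B] (x : B) (n : ℕ) :
    nsm (OrderDual.toDual x) n = OrderDual.toDual (nsm x n) := by
  rcases Nat.eq_zero_or_pos n with rfl | hn
  · rfl
  · exact (map_nsm (f := OrderDual.toDual (α := B)) (fun _ _ => rfl) x hn).symm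

section Ordered

variable {B : Type*} [AddCommSemigroup B] [LinearOrder B]

theorem add_lt_add_iff_of_forall (hadd : ∀ x y z : B, x < y → x + z < y + z) (x y z : B) :
    x + z < y + z ↔ x < y :=
  (show StrictMono (· + z) from fun _ _ h => hadd _ _ z h).lt_iff_lt

theorem add_le_add_iff_of_forall (hadd : ∀ x y z : B, x < y → x + z < y + z) (x y z : B) :
    x + z ≤ y + z ↔ x ≤ y :=
  (show StrictMono (· + z) from fun _ _ h => hadd _ _ z h).le_iff_le

theorem lt_add_of_lt_add_self (hadd : ∀ x y z : B, x < y → x + z < y + z) {b : B}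
    (hb : b < b + b) (y : B) : y < y + b := by
  have h := hadd _ _ y hb
  rw [← add_lt_add_iff_of_forall hadd _ _ b]
  convert h using 1 <;> ac_rfl

theorem nsm_strictMono_left (hadd : ∀ x y z : B, x < y → x + z < y + z) {x y : B}
    (h : x < y) {n : ℕ} (hn : 1 ≤ n) : nsm x n < nsm y n := by
  induction n, hn using Nat.le_induction with
  | base => exact h
  | succ n hn ih =>
    rw [nsm_succ _ hn, nsm_succ _ hn]
    refine (hadd _ _ x ih).trans ?_
    rw [add_comm _ x, add_comm _ y]
    exact hadd _ _ _ h

theorem le_nsm (hadd : ∀ x y z : B, x < y → x + z < y + z) {b y : B}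
    (hb : b < b + b) (hby : b ≤ y) {n : ℕ} (hn : 1 ≤ n) : b ≤ nsm y n := by
  induction n, hn using Nat.le_induction with
  | base => exact hby
  | succ n hn ih =>
    rw [nsm_succ _ hn]
    calc b ≤ y := hby
      _ ≤ y + b := (lt_add_of_lt_add_self hadd hb y).le
      _ = b + y := add_comm _ _
      _ ≤ nsm y n + y := (add_le_add_iff_of_forall hadd _ _ _).2 ih

/-- Multiples of a positive element are cofinal. -/
theorem exists_le_nsm (hadd : ∀ x y z : B, x < y → x + z < y + z)
    (hna : ∀ x y : B, ¬ IsAddAnomalousPair x y) {b : B} (hb : b < b + b) (y : B) :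
    ∃ n, 1 ≤ n ∧ y ≤ nsm b n := by
  by_contra! h
  refine hna (y + b) y ⟨lt_add_of_lt_add_self hadd hb y, .inl fun n hn => ?_⟩
  rw [nsm_add _ _ hn, nsm_succ _ hn, add_comm, add_comm _ y]
  exact hadd _ _ _ (h n hn)

/-- Translating by multiples of a positive element makes any element large. -/
theorem exists_le_add_nsm (hadd : ∀ x y z : B, x < y → x + z < y + z)
    (hna : ∀ x y : B, ¬ IsAddAnomalousPair x y) {b : B} (hb : b < b + b) (y : B) :
    ∃ n, 1 ≤ n ∧ b ≤ y + nsm b n := by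
  by_contra! h
  refine hna (y + b) y ⟨lt_add_of_lt_add_self hadd hb y, .inr fun n hn => ?_⟩
  have hn' : 1 ≤ n + 1 := by omega
  have key := hadd _ _ (nsm y n) (h (n + 2) (by omega))
  rw [nsm_succ _ hn'] at key
  rw [nsm_add _ _ hn', nsm_succ y hn, ← add_lt_add_iff_of_forall hadd _ _ b]
  convert key using 1 <;> ac_rfl

/-- A multiple of a positive `b` separates suitable equal multiples of `y < z`, when `b ≤ y`. -/
theorem exists_nsm_between (hadd : ∀ x y z : B, x < y → x + z < y + z)
    (hna : ∀ x y : B, ¬ IsAddAnomalousPair x y) {b y z : B} (hb : b < b + b)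
    (hby : b ≤ y) (hyz : y < z) :
    ∃ p q, 1 ≤ p ∧ 1 ≤ q ∧ nsm y q ≤ nsm b p ∧ nsm b p ≤ nsm z q := by
  obtain ⟨q, hq, hqle⟩ : ∃ q, 1 ≤ q ∧ nsm y (q + 1) ≤ nsm z q := by
    by_contra! h
    exact hna z y ⟨hyz, .inl h⟩
  have hgap : nsm y q + b ≤ nsm z q := by
    refine le_trans ?_ hqle
    rw [nsm_succ _ hq, add_comm, add_comm _ y]
    exact (add_le_add_iff_of_forall hadd _ _ _).2 hby
  classical
  have hex := exists_le_nsm hadd hna hb (nsm y q)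
  obtain ⟨hp, hle⟩ := Nat.find_spec hex
  refine ⟨Nat.find hex, q, hp, hq, hle, le_trans ?_ hgap⟩
  obtain ⟨m, hm⟩ := Nat.exists_eq_add_of_le' hp
  rw [hm]
  rcases Nat.eq_zero_or_pos m with rfl | hmpos
  · exact (le_nsm hadd hb hby hq).trans (lt_add_of_lt_add_self hadd hb _).le
  · have hlt : nsm b m < nsm y q := by
      by_contra! hge
      exact Nat.find_min hex (by omega) ⟨hmpos, hge⟩
    rw [nsm_succ _ hmpos]
    exact (hadd _ _ b hlt).le

/-- Two additive maps inducing the same order, and agreeing at a point with positive image,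
are comparable in only one way. -/
theorem not_lt_of_forall_lt_iff_lt {A : Type*} [AddCommSemigroup A]
    (hadd : ∀ x y z : B, x < y → x + z < y + z)
    (hna : ∀ x y : B, ¬ IsAddAnomalousPair x y) {f g : A → B}
    (hf : ∀ x y, f (x + y) = f x + f y) (hg : ∀ x y, g (x + y) = g x + g y)
    (hfg : ∀ x y, f x < f y ↔ g x < g y) {a : A} (ha : f a = g a)
    (hpos : f a < f a + f a) (x : A) : ¬ f x < g x := by
  intro hx
  obtain ⟨k, hk, hbk⟩ := exists_le_add_nsm hadd hna hpos (f x)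
  have hfu : f (x + nsm a k) = f x + nsm (f a) k := by rw [hf, map_nsm hf _ hk]
  have hgu : g (x + nsm a k) = g x + nsm (f a) k := by rw [hg, map_nsm hg _ hk, ha]
  obtain ⟨p, q, hp, hq, h₁, h₂⟩ := exists_nsm_between hadd hna hpos hbk (hadd _ _ _ hx)
  have hlt := nsm_strictMono_left hadd (hadd _ _ (nsm (f a) k) hx) hq
  have hiff := hfg (nsm (x + nsm a k) q) (nsm a p)
  have hiff' := hfg (nsm a p) (nsm (x + nsm a k) q)
  rw [map_nsm hf _ hq, map_nsm hg _ hq, map_nsm hf _ hp, map_nsm hg _ hp, hfu, hgu, ← ha]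
    at hiff hiff'
  rcases h₁.lt_or_eq with h | h
  · exact (hiff.1 h).not_ge h₂
  · exact (hiff'.2 (h ▸ hlt)).ne' h

theorem eq_of_forall_lt_iff_lt_of_pos {A : Type*} [AddCommSemigroup A]
    (hadd : ∀ x y z : B, x < y → x + z < y + z)
    (hna : ∀ x y : B, ¬ IsAddAnomalousPair x y) {f g : A → B}
    (hf : ∀ x y, f (x + y) = f x + f y) (hg : ∀ x y, g (x + y) = g x + g y)
    (hfg : ∀ x y, f x < f y ↔ g x < g y) {a : A} (ha : f a = g a)
    (hpos : f a < f a + f a) : f = g :=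
  funext fun x => le_antisymm
    (not_lt.1 (not_lt_of_forall_lt_iff_lt hadd hna hg hf (fun x y => (hfg x y).symm) ha.symm
      (ha ▸ hpos) x))
    (not_lt.1 (not_lt_of_forall_lt_iff_lt hadd hna hf hg hfg ha hpos x))

theorem not_isAddAnomalousPair_orderDual (hna : ∀ x y : B, ¬ IsAddAnomalousPair x y)
    (x y : Bᵒᵈ) : ¬ IsAddAnomalousPair x y := by
  induction x using OrderDual.rec with | _ x
  induction y using OrderDual.rec with | _ y
  rintro ⟨hlt, h⟩
  simp only [nsm_toDual, OrderDual.toDual_lt_toDual] at hlt h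
  exact hna y x ⟨hlt, h.symm⟩

theorem eq_of_forall_lt_iff_lt {A : Type*} [AddCommSemigroup A]
    (hadd : ∀ x y z : B, x < y → x + z < y + z)
    (hna : ∀ x y : B, ¬ IsAddAnomalousPair x y) {f g : A → B}
    (hf : ∀ x y, f (x + y) = f x + f y) (hg : ∀ x y, g (x + y) = g x + g y)
    (hfg : ∀ x y, f x < f y ↔ g x < g y) {a : A} (ha : f a = g a)
    (hne : f a + f a ≠ f a) : f = g := by
  rcases hne.lt_or_gt with h | h
  · exact eq_of_forall_lt_iff_lt_of_pos (B := Bᵒᵈ) (fun x y z h => hadd y x z h)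
      (not_isAddAnomalousPair_orderDual hna) hf hg (fun x y => hfg y x) ha h
  · exact eq_of_forall_lt_iff_lt_of_pos hadd hna hf hg hfg ha h

end Ordered

/-- A strictly monotone and a strictly antitone additive map differ at non-idempotents. -/
theorem StrictMono.apply_ne_of_strictAnti {A B : Type*} [Add A] [LinearOrder A] [Add B]
    [Preorder B] {f g : A → B} (hfm : StrictMono f) (hga : StrictAnti g)
    (hf : ∀ x y, f (x + y) = f x + f y) (hg : ∀ x y, g (x + y) = g x + g y)
    {a : A} (ha : a + a ≠ a) : f a ≠ g a := by
  intro h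
  rcases ha.lt_or_gt with h' | h'
  all_goals
    have h₁ := hfm h'
    have h₂ := hga h'
    rw [hf, h] at h₁
    rw [hg] at h₂
    exact lt_asymm h₁ h₂

/-- A morphism between non-anomalous commutative totally ordered additive semigroups
is determined by where it maps a single non-identity element. -/
theorem stmt6 {A B : Type*} [AddCommSemigroup A] [LinearOrder A]
    [AddCommSemigroup B] [LinearOrder B]
    (haddA : ∀ x y z : A, x < y → x + z < y + z)
    (haddB : ∀ x y z : B, x < y → x + z < y + z)
    (hnaA : ∀ x y : A, ¬ IsAddAnomalousPair x y)
    (hnaB : ∀ x y : B, ¬ IsAddAnomalousPair x y)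
    (f₁ f₂ : A → B) (hf₁ : IsMorphism f₁) (hf₂ : IsMorphism f₂)
    (a : A) (ha : a + a ≠ a) (heq : f₁ a = f₂ a) :
    f₁ = f₂ := by
  obtain ⟨hadd₁, hmono₁⟩ := hf₁
  obtain ⟨hadd₂, hmono₂⟩ := hf₂
  have hne : f₁ a + f₁ a ≠ f₁ a := by
    rw [← hadd₁]
    exact (hmono₁.elim StrictMono.injective StrictAnti.injective).ne ha
  refine eq_of_forall_lt_iff_lt haddB hnaB hadd₁ hadd₂ (fun x y => ?_) heq hne
  rcases hmono₁ with h₁ | h₁ <;> rcases hmono₂ with h₂ | h₂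
  · rw [h₁.lt_iff_lt, h₂.lt_iff_lt]
  · exact absurd heq (h₁.apply_ne_of_strictAnti h₂ hadd₁ hadd₂ ha)
  · exact absurd heq.symm (h₂.apply_ne_of_strictAnti h₁ hadd₂ hadd₁ ha)
  · rw [h₁.lt_iff_gt, h₂.lt_iff_gt]
end

section
/- Let (Aᵢ, aᵢ) for i in an index set I be a family where each Aᵢ is a non-anomalous commutative totally ordered additive semigroup and each aᵢ ∈ Aᵢ is a non-identity element. Then there exist a non-anomalous commutative totally ordered additive semigroup U, an element u ∈ U, and for each i ∈ I a morphism fᵢ : Aᵢ → U with fᵢ(aᵢ) = u. -/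
/-- A bundled non-anomalous commutative totally ordered additive semigroup. -/
structure NASemigroup where
  carrier : Type*
  [acs : AddCommSemigroup carrier]
  [lo : LinearOrder carrier]
  add_lt : ∀ x y z : carrier, x < y → x + z < y + z
  nonAnom : ∀ x y : carrier, ¬ IsAddAnomalousPair x y

attribute [instance] NASemigroup.acs NASemigroup.lo

theorem nsm_eq_nsmul {G : Type*} [AddCommGroup G] {A : Type*} [Add A] (i : A → G)
    (hi : ∀ x y, i (x + y) = i x + i y) (x : A) {n : ℕ} (hn : 1 ≤ n) :
    i (nsm x n) = n • i x := by
  induction n, hn using Nat.le_induction with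
  | base => simp [nsm]
  | succ n hn ih =>
    obtain ⟨k, rfl⟩ := Nat.exists_eq_add_of_le' hn
    rw [nsm, hi, ih, succ_nsmul _ (k + 1)]

/-- A linearly ordered group of differences of a semigroup without anomalous pairs is
archimedean. -/
theorem archimedean_of_differences {A : Type*} [AddCommSemigroup A] [LinearOrder A]
    (hna : ∀ x y : A, ¬ IsAddAnomalousPair x y)
    {G : Type*} [AddCommGroup G] [LinearOrder G] [IsOrderedAddMonoid G] (i : A → G)
    (hi : ∀ x y, i (x + y) = i x + i y) (hmono : StrictMono i)
    (hsurj : ∀ g, ∃ x y, g = i x - i y) : Archimedean G := by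
  have bound : ∀ {x y : A}, y < x → ∃ n : ℕ, i x ≤ n • (i x - i y) ∧ -i x ≤ n • (i x - i y) := by
    intro x y hxy
    have h := hna x y
    simp only [IsAddAnomalousPair, hxy, true_and, not_or, not_forall, not_lt, exists_prop] at h
    obtain ⟨⟨n, hn, hnxy⟩, m, hm, hmxy⟩ := h
    have hv : 0 ≤ i x - i y := sub_nonneg.2 (hmono hxy).le
    rw [← hmono.le_iff_le, nsm_eq_nsmul i hi _ hn, nsm_eq_nsmul i hi _ (by lia), succ_nsmul]
      at hnxy
    rw [← hmono.le_iff_le, nsm_eq_nsmul i hi _ hm, nsm_eq_nsmul i hi _ (by lia), succ_nsmul]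
      at hmxy
    have h₁ : i x ≤ (n + 1) • (i x - i y) := by
      rw [succ_nsmul, nsmul_sub, ← sub_nonneg]
      convert sub_nonneg.2 hnxy using 1
      abel
    have h₂ : -i x ≤ m • (i x - i y) := by
      rw [nsmul_sub, ← sub_nonneg]
      convert sub_nonneg.2 hmxy using 1
      abel
    exact ⟨n + 1 + m, h₁.trans (nsmul_le_nsmul_left hv (by lia)),
      h₂.trans (nsmul_le_nsmul_left hv (by lia))⟩
  refine ⟨fun g v hv => ?_⟩
  obtain ⟨x, y, rfl⟩ := hsurj v
  have hxy : y < x := hmono.lt_iff_lt.1 (sub_pos.1 hv)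
  have bound' : ∀ z, ∃ n : ℕ, i z ≤ n • (i x - i y) ∧ -i z ≤ n • (i x - i y) := by
    intro z
    have hxyz : y + z < x + z := by
      rw [← hmono.lt_iff_lt, hi, hi]
      exact add_lt_add_left (hmono hxy) _
    obtain ⟨n, h₁, h₂⟩ := bound hxy
    obtain ⟨m, h₃, h₄⟩ := bound hxyz
    rw [hi, hi, add_sub_add_right_eq_sub] at h₃ h₄
    refine ⟨n + m, ?_, ?_⟩
    · rw [add_nsmul]
      convert add_le_add h₂ h₃ using 1
      abel
    · rw [add_nsmul]
      convert add_le_add h₁ h₄ using 1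
      abel
  obtain ⟨p, q, rfl⟩ := hsurj g
  obtain ⟨n, hn, -⟩ := bound' p
  obtain ⟨m, -, hm⟩ := bound' q
  refine ⟨n + m, ?_⟩
  rw [add_nsmul, sub_eq_add_neg (i p)]
  exact add_le_add hn hm

open Algebra in
/-- A semigroup without anomalous pairs embeds into `ℝ` as soon as it embeds into an ordered
cancellative monoid all of whose elements are differences of elements of the semigroup. -/
theorem exists_real_embedding_of_monoid {A : Type*} [AddCommSemigroup A] [LinearOrder A]
    (hna : ∀ x y : A, ¬ IsAddAnomalousPair x y)
    {M : Type*} [AddCommMonoid M] [LinearOrder M] [IsOrderedCancelAddMonoid M] (j : A → M)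
    (hj : ∀ x y, j (x + y) = j x + j y) (hmono : StrictMono j)
    (hdiff : ∀ m, ∃ x y, m + j x = j y) :
    ∃ f : A → ℝ, (∀ x y, f (x + y) = f x + f y) ∧ StrictMono f := by
  let i : M →+ GrothendieckAddGroup M := GrothendieckAddGroup.of
  have hi : ∀ m, i m = AddLocalization.mk m 0 := fun m =>
    (AddLocalization.mk_zero_eq_addMonoidOf_mk m).symm
  have himono : StrictMono i := fun m n h => by
    rw [hi, hi, AddLocalization.mk_lt_mk]
    simpa using h
  have hdiff' : ∀ m, ∃ x y, i m = i (j y) - i (j x) := fun m => by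
    obtain ⟨x, y, h⟩ := hdiff m
    exact ⟨x, y, by rw [← h, map_add, add_sub_cancel_right]⟩
  have hadd : ∀ x y, i (j (x + y)) = i (j x) + i (j y) := fun x y => by rw [hj, map_add]
  have : Archimedean (GrothendieckAddGroup M) := by
    refine archimedean_of_differences hna (fun x => i (j x)) hadd (himono.comp hmono) fun g => ?_
    obtain ⟨m, n, rfl⟩ : ∃ m n, g = i m - i n := by
      induction g using AddLocalization.induction_on with
      | H p => exact ⟨p.1, p.2, by simp [hi]⟩
    obtain ⟨x, y, h⟩ := hdiff' m
    obtain ⟨z, w, h'⟩ := hdiff' n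
    refine ⟨y + z, x + w, ?_⟩
    rw [h, h', hadd, hadd]
    abel
  obtain ⟨φ, hφ⟩ := Archimedean.exists_orderAddMonoidHom_real_injective (GrothendieckAddGroup M)
  exact ⟨fun x => φ (i (j x)), fun x y => by simp only [hadd, map_add],
    (φ.monotone'.strictMono_of_injective hφ).comp (himono.comp hmono)⟩

/-- A semigroup with an adjoined zero, carrying no order. -/
def AdjoinZero (A : Type*) : Type _ := WithZero A

namespace AdjoinZero

variable {A : Type*} [AddCommSemigroup A]

instance : AddCommMonoid (AdjoinZero A) := inferInstanceAs (AddCommMonoid (WithZero A))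

/-- The inclusion of a semigroup into itself with an adjoined zero. -/
def of (x : A) : AdjoinZero A := (x : WithZero A)

theorem of_add (x y : A) : of (x + y) = of x + of y := WithZero.coe_add x y

theorem zero_or_of (u : AdjoinZero A) : u = 0 ∨ ∃ x, u = of x := by
  induction u using WithZero.recZeroCoe with
  | zero => exact .inl rfl
  | coe x => exact .inr ⟨x, rfl⟩

/-- Translation by `a` on a semigroup with an adjoined zero. -/
def shift (a : A) (u : AdjoinZero A) : A :=
  WithZero.recZeroCoe a (fun x => x + a) u

theorem shift_zero (a : A) : shift a 0 = a := rfl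

theorem shift_of (a x : A) : shift a (of x) = x + a := rfl

theorem shift_of_add (a x : A) (u : AdjoinZero A) : shift a (of x + u) = x + shift a u := by
  obtain rfl | ⟨y, rfl⟩ := zero_or_of u
  · rw [add_zero, shift_of, shift_zero]
  · rw [← of_add, shift_of, shift_of, add_assoc]

end AdjoinZero

/-- A commutative totally ordered semigroup without anomalous pairs embeds into `ℝ`. -/
theorem exists_real_embedding {A : Type*} [AddCommSemigroup A] [LinearOrder A]
    (hadd : ∀ x y z : A, x < y → x + z < y + z)
    (hna : ∀ x y : A, ¬ IsAddAnomalousPair x y) (a : A) :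
    ∃ f : A → ℝ, (∀ x y, f (x + y) = f x + f y) ∧ StrictMono f := by
  have hmono : ∀ z : A, StrictMono (· + z) := fun z x y => hadd x y z
  by_cases h : ∃ e : A, e + a = a
  · obtain ⟨e, he⟩ := h
    have hzero : ∀ x, e + x = x := fun x => (hmono a).injective <| by
      simp only [add_right_comm e x a, he, add_comm x a]
    let _ : Zero A := ⟨e⟩
    let _ : AddCommMonoid A :=
      { zero_add := hzero
        add_zero := fun x => (add_comm x e).trans (hzero x)
        add_comm := add_comm
        nsmul := nsmulRec }
    have : IsOrderedCancelAddMonoid A :=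
      { add_le_add_left := fun x y h z => (hmono z).monotone h
        le_of_add_le_add_left := fun x y z h => by
          rwa [add_comm x, add_comm x, (hmono x).le_iff_le] at h }
    exact exists_real_embedding_of_monoid hna (M := A) id (fun _ _ => rfl) strictMono_id
      fun m => ⟨m, m + m, rfl⟩
  · have hinj : Function.Injective (AdjoinZero.shift a) := by
      intro u v huv
      obtain rfl | ⟨x, rfl⟩ := u.zero_or_of <;> obtain rfl | ⟨y, rfl⟩ := v.zero_or_of
      · rfl
      · exact (h ⟨y, huv.symm⟩).elim
      · exact (h ⟨x, huv⟩).elim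
      · exact congrArg _ ((hmono a).injective huv)
    let _ : LinearOrder (AdjoinZero A) := LinearOrder.lift' (AdjoinZero.shift a) hinj
    have hle : ∀ u v w : AdjoinZero A, w + u ≤ w + v ↔ u ≤ v := by
      intro u v w
      obtain rfl | ⟨x, rfl⟩ := w.zero_or_of
      · simp only [zero_add]
      · change AdjoinZero.shift a (.of x + u) ≤ AdjoinZero.shift a (.of x + v) ↔ _
        rw [AdjoinZero.shift_of_add, AdjoinZero.shift_of_add, add_comm x, add_comm x]
        exact (hmono x).le_iff_le
    have : IsOrderedCancelAddMonoid (AdjoinZero A) :=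
      { add_le_add_left := fun u v h w => by rwa [add_comm u, add_comm v, hle]
        le_of_add_le_add_left := fun u v w => (hle v w u).1 }
    refine exists_real_embedding_of_monoid hna (M := AdjoinZero A) AdjoinZero.of
      AdjoinZero.of_add (fun x y hxy => hmono a hxy) fun u => ⟨a, AdjoinZero.shift a u, ?_⟩
    obtain rfl | ⟨x, rfl⟩ := u.zero_or_of
    · rw [zero_add, AdjoinZero.shift_zero]
    · rw [AdjoinZero.shift_of, AdjoinZero.of_add]

/-- The embedding into `ℝ` can be rescaled to send a given non-identity element to `1`. -/
theorem exists_isMorphism_real_eq_one {A : Type*} [AddCommSemigroup A] [LinearOrder A]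
    (hadd : ∀ x y z : A, x < y → x + z < y + z)
    (hna : ∀ x y : A, ¬ IsAddAnomalousPair x y) (a : A) (ha : a + a ≠ a) :
    ∃ f : A → ℝ, IsMorphism f ∧ f a = 1 := by
  obtain ⟨f, hf, hmono⟩ := exists_real_embedding hadd hna a
  have hfa : f a ≠ 0 := fun h => ha <| hmono.injective <| by rw [hf, h, add_zero]
  refine ⟨fun x => f x / f a, ⟨fun x y => by simp only [hf, add_div], ?_⟩, div_self hfa⟩
  rcases hfa.lt_or_gt with h | h
  · exact .inr fun x y hxy => div_lt_div_of_neg_of_lt h (hmono hxy)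
  · exact .inl fun x y hxy => div_lt_div_of_pos_right (hmono hxy) h

theorem not_isAddAnomalousPair_real {A : Type*} [Add A] [LT A] (i : A → ℝ)
    (hi : ∀ x y, i (x + y) = i x + i y) (hlt : ∀ x y, x < y ↔ i x < i y) (x y : A) :
    ¬ IsAddAnomalousPair x y := by
  rintro ⟨hxy, h⟩
  rw [hlt] at hxy
  obtain ⟨n, hn⟩ := Archimedean.arch (|i x| + |i y|) (sub_pos.2 hxy)
  rw [nsmul_eq_mul] at hn
  rcases h with h | h <;>
  · have h := (hlt _ _).1 (h (n + 1) (by lia))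
    rw [nsm_eq_nsmul i hi _ (by lia), nsm_eq_nsmul i hi _ (by lia)] at h
    simp only [nsmul_eq_mul] at h
    push_cast at h
    linarith [le_abs_self (i y), neg_abs_le (i x), abs_nonneg (i x), abs_nonneg (i y)]

/-- The additive semigroup of real numbers, in an arbitrary universe. -/
noncomputable def NASemigroup.real : NASemigroup where
  carrier := ULift ℝ
  add_lt _ _ z h := add_lt_add_left (α := ℝ) h z.down
  nonAnom := not_isAddAnomalousPair_real ULift.down (fun _ _ => rfl) fun _ _ => Iff.rfl

/-- For any family `(Aᵢ, aᵢ)` of pointed non-anomalous commutative totally ordered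
additive semigroups, there is a non-anomalous commutative totally ordered additive
semigroup `U`, a point `u ∈ U`, and morphisms `fᵢ : Aᵢ → U` with `fᵢ(aᵢ) = u`. -/
theorem stmt7 {ι : Type*} (A : ι → Type*)
    [∀ i, AddCommSemigroup (A i)] [∀ i, LinearOrder (A i)]
    (haddA : ∀ i, ∀ x y z : A i, x < y → x + z < y + z)
    (hnaA : ∀ i, ∀ x y : A i, ¬ IsAddAnomalousPair x y)
    (a : ∀ i, A i) (ha : ∀ i, a i + a i ≠ a i) :
    ∃ (U : NASemigroup) (u : U.carrier) (f : ∀ i, A i → U.carrier),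
      ∀ i, IsMorphism (f i) ∧ f i (a i) = u := by
  choose f hf hfa using fun i => exists_isMorphism_real_eq_one (haddA i) (hnaA i) (a i) (ha i)
  exact ⟨NASemigroup.real, ULift.up 1, fun i x => ULift.up (f i x), fun i =>
    ⟨⟨fun x y => congrArg ULift.up ((hf i).1 x y), (hf i).2⟩, congrArg ULift.up (hfa i)⟩⟩
end

section
/- Let A and B be non-anomalous commutative totally ordered additive semigroups, where A contains a non-identity element. Let i : A → ℝ and j : B → ℝ be morphisms into the reals (as an additive ordered semigroup), and let f : A → B be a morphism. Then there exists a real number λ such that λ * i(a) = j(f(a)) for every a ∈ A. -/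
theorem map_nsm_succ {A : Type*} [Add A] {φ : A → ℝ}
    (hφ : ∀ x y, φ (x + y) = φ x + φ y) (a : A) (n : ℕ) :
    φ (nsm a (n + 1)) = (n + 1) * φ a := by
  induction n with
  | zero => simp [nsm]
  | succ n ih =>
    rw [show nsm a (n + 1 + 1) = nsm a (n + 1) + a from rfl, hφ, ih]
    push_cast
    ring

theorem div_le_div_of_lt_imp_lt {A : Type*} [Add A] {φ ψ : A → ℝ}
    (hφ : ∀ x y, φ (x + y) = φ x + φ y) (hψ : ∀ x y, ψ (x + y) = ψ x + ψ y)
    (h : ∀ x y, φ x < φ y → ψ x < ψ y) {a : A} (ha : 0 < φ a) (ha' : 0 < ψ a) (b : A) :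
    ψ b / ψ a ≤ φ b / φ a := by
  by_contra! hlt
  obtain ⟨r, hr₁, hr₂⟩ := exists_rat_btwn hlt
  have hden : (0 : ℝ) < r.den := by exact_mod_cast r.den_pos
  have hr : (r : ℝ) = ((r.num.toNat : ℝ) - ((-r.num).toNat : ℝ)) / r.den := by
    have hnum : (r.num : ℝ) = (r.num.toNat : ℝ) - ((-r.num).toNat : ℝ) := by
      exact_mod_cast (Int.toNat_sub_toNat_neg r.num).symm
    rw [← hnum, Rat.cast_def]
  rw [hr, div_lt_div_iff₀ ha hden] at hr₁
  rw [hr, div_lt_div_iff₀ hden ha'] at hr₂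
  have key := h (nsm b (r.den + 1) + nsm a ((-r.num).toNat + 1))
    (nsm b (0 + 1) + nsm a (r.num.toNat + 1))
  simp only [hφ, hψ, map_nsm_succ hφ, map_nsm_succ hψ, Nat.cast_zero] at key
  have := key (by linarith)
  linarith

theorem div_eq_div_of_lt_iff_lt {A : Type*} [Add A] {φ ψ : A → ℝ}
    (hφ : ∀ x y, φ (x + y) = φ x + φ y) (hψ : ∀ x y, ψ (x + y) = ψ x + ψ y)
    (h : ∀ x y, φ x < φ y ↔ ψ x < ψ y) {a : A} (ha : φ a ≠ 0) (b : A) :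
    ψ b / ψ a = φ b / φ a ∧ ψ a ≠ 0 := by
  rcases ha.lt_or_gt with ha | ha
  · have ha' : ψ a < 0 := by
      have := (h (a + a) a).1 (by rw [hφ]; linarith)
      rw [hψ] at this
      linarith
    have h₁ := div_le_div_of_lt_imp_lt (φ := fun x => -φ x) (ψ := fun x => -ψ x)
      (fun x y => by rw [hφ]; ring) (fun x y => by rw [hψ]; ring)
      (fun x y hxy => neg_lt_neg ((h y x).1 (neg_lt_neg_iff.1 hxy)))
      (a := a) (neg_pos.2 ha) (neg_pos.2 ha') b
    have h₂ := div_le_div_of_lt_imp_lt (φ := fun x => -ψ x) (ψ := fun x => -φ x)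
      (fun x y => by rw [hψ]; ring) (fun x y => by rw [hφ]; ring)
      (fun x y hxy => neg_lt_neg ((h y x).2 (neg_lt_neg_iff.1 hxy)))
      (a := a) (neg_pos.2 ha') (neg_pos.2 ha) b
    simp only [neg_div_neg_eq] at h₁ h₂
    exact ⟨le_antisymm h₁ h₂, ha'.ne⟩
  · have ha' : 0 < ψ a := by
      have := (h a (a + a)).1 (by rw [hφ]; linarith)
      rw [hψ] at this
      linarith
    exact ⟨le_antisymm (div_le_div_of_lt_imp_lt hφ hψ (fun x y => (h x y).1) ha ha' b)
      (div_le_div_of_lt_imp_lt hψ hφ (fun x y => (h x y).2) ha' ha b), ha'.ne'⟩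

theorem exists_mul_eq_of_lt_iff_lt {A : Type*} [Add A] {φ ψ : A → ℝ}
    (hφ : ∀ x y, φ (x + y) = φ x + φ y) (hψ : ∀ x y, ψ (x + y) = ψ x + ψ y)
    (h : ∀ x y, φ x < φ y ↔ ψ x < ψ y) {a : A} (ha : φ a ≠ 0) :
    ∃ l : ℝ, ∀ b, l * φ b = ψ b := by
  refine ⟨ψ a / φ a, fun b => ?_⟩
  obtain ⟨hab, ha'⟩ := div_eq_div_of_lt_iff_lt hφ hψ h ha b
  rw [div_eq_div_iff ha' ha] at hab
  rw [div_mul_eq_mul_div, div_eq_iff ha]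
  linarith

theorem IsMorphism.comp {A B C : Type*} [Add A] [Add B] [Add C] [Preorder A] [Preorder B]
    [Preorder C] {g : B → C} {f : A → B} (hg : IsMorphism g) (hf : IsMorphism f) :
    IsMorphism (fun a => g (f a)) := by
  refine ⟨fun x y => by simp only [hf.1, hg.1], ?_⟩
  rcases hg.2 with hg | hg <;> rcases hf.2 with hf | hf
  · exact .inl (hg.comp hf)
  · exact .inr (hg.comp_strictAnti hf)
  · exact .inr (hg.comp_strictMono hf)
  · exact .inl (hg.comp hf)

/-- Given non-anomalous commutative totally ordered additive semigroups `A` (with a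
non-identity element) and `B`, morphisms `i : A → ℝ`, `j : B → ℝ`, and a morphism
`f : A → B`, there is a real number `λ` with `λ * i(a) = j(f(a))` for every `a`. -/
theorem stmt19 {A B : Type*} [AddCommSemigroup A] [LinearOrder A]
    [AddCommSemigroup B] [LinearOrder B]
    (haddA : ∀ x y z : A, x < y → x + z < y + z)
    (haddB : ∀ x y z : B, x < y → x + z < y + z)
    (hnaA : ∀ x y : A, ¬ IsAddAnomalousPair x y)
    (hnaB : ∀ x y : B, ¬ IsAddAnomalousPair x y)
    (a₀ : A) (ha₀ : a₀ + a₀ ≠ a₀)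
    (i : A → ℝ) (hi : IsMorphism i)
    (j : B → ℝ) (hj : IsMorphism j)
    (f : A → B) (hf : IsMorphism f) :
    ∃ l : ℝ, ∀ a : A, l * i a = j (f a) := by
  have hg : IsMorphism (fun a => j (f a)) := hj.comp hf
  have hinj : Function.Injective i := hi.2.elim StrictMono.injective StrictAnti.injective
  have hi₀ : i a₀ ≠ 0 := fun h => ha₀ (hinj (by rw [hi.1, h, add_zero]))
  have hneg : ∀ x y, -j (f (x + y)) = -j (f x) + -j (f y) := fun x y => by
    rw [hf.1, hj.1, neg_add]
  have of_neg : (∀ x y, i x < i y ↔ -j (f x) < -j (f y)) →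
      ∃ l : ℝ, ∀ a : A, l * i a = j (f a) := fun h => by
    obtain ⟨l, hl⟩ := exists_mul_eq_of_lt_iff_lt hi.1 hneg h hi₀
    exact ⟨-l, fun a => by rw [neg_mul, hl, neg_neg]⟩
  rcases hi.2 with hi' | hi' <;> rcases hg.2 with hg' | hg'
  · exact exists_mul_eq_of_lt_iff_lt hi.1 hg.1
      (fun x y => hi'.lt_iff_lt.trans hg'.lt_iff_lt.symm) hi₀
  · exact of_neg fun x y => hi'.lt_iff_lt.trans (hg'.lt_iff_gt.symm.trans neg_lt_neg_iff.symm)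
  · exact of_neg fun x y => hi'.lt_iff_gt.trans (hg'.lt_iff_lt.symm.trans neg_lt_neg_iff.symm)
  · exact exists_mul_eq_of_lt_iff_lt hi.1 hg.1
      (fun x y => hi'.lt_iff_gt.trans hg'.lt_iff_gt.symm) hi₀
end
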